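/- Let (A, 𝒜) be a Poincaré duality algebra of formal dimension n over the field R. Let r < q < n be positive integers such that 𝒜 i = ⊥ for all i with 0 < i < r, 𝒜 r ≠ ⊥, and 𝒜 i = ⊥ for all i with r < i < q. Suppose 𝒜 r is finite-dimensional with basis a_1, …, a_t (as an R-vector space), and there are positive integers k_1, …, k_t with a_j^{k_j + 1} = 0 for every j and r · (k_1 + ⋯ + k_t) < n. Then whenever b_1, …, b_c are homogeneous elements of A of positive degree with b_1 ⋯ b_c ≠ 0, one has c ≤ k_1 + ⋯ + k_t + ⌊(n − r(k_1 + ⋯ + k_t))/q⌋; moreover this bound is strictly less than n/r. (Theorem A(b1).) -/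

import Mathlib

open Finset in
lemma ideal_pow_zero {A : Type*} [CommRing A] {ι : Type*} [DecidableEq ι] (S : Finset ι) (x : ι → A) (k : ι → ℕ)
    (h : ∀ j, x j ^ (k j + 1) = 0) :
    (∑ j ∈ S, Ideal.span {x j}) ^ (∑ j ∈ S, k j + 1) = (0 : Ideal A) := by
  induction S using Finset.induction_on with
  | empty => simp
  | insert a S ha ih =>
    rw [Finset.sum_insert ha, Finset.sum_insert ha]
    refine (Commute.all _ _).add_pow_eq_zero_of_add_le_succ_of_pow_eq_zero
      (m := k a + 1) (n := ∑ j ∈ S, k j + 1) ?_ ih (by omega)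
    rw [Ideal.span_singleton_pow, h]
    simp

/-- Theorem A(b1): suppose `r < q < n` are the degrees of the first two nonzero
positive-degree components of a Poincaré duality algebra of formal dimension `n`, and
`𝒜 r` has a basis `b 1, …, b t` with `(b j) ^ (k j + 1) = 0` and `r * (k 1 + ⋯ + k t) < n`.
Then any nonzero product of `c` homogeneous positive-degree elements satisfies
`c ≤ k 1 + ⋯ + k t + ⌊(n − r (k 1 + ⋯ + k t)) / q⌋`, and this bound is strictly smaller
than `n / r`. -/
theorem cupLength_upper_bound_of_basis_heights
    {R A : Type*} [Field R] [CommRing A] [Algebra R A]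
    (𝒜 : ℕ → Submodule R A) [GradedAlgebra 𝒜] (n : ℕ) (hn : 0 < n)
    (htop : ∀ i, n < i → 𝒜 i = ⊥) (hntop : 𝒜 n ≠ ⊥)
    (hdual : ∀ k, k ≤ n → ∀ x ∈ 𝒜 k, x ≠ 0 → ∃ y ∈ 𝒜 (n - k), x * y ≠ 0)
    (r q : ℕ) (hr : 0 < r) (hrq : r < q) (hqn : q < n)
    (hgap₁ : ∀ i, 0 < i → i < r → 𝒜 i = ⊥) (hr_ne : 𝒜 r ≠ ⊥)
    (hgap₂ : ∀ i, r < i → i < q → 𝒜 i = ⊥)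
    (t : ℕ) (b : Module.Basis (Fin t) R (𝒜 r)) (k : Fin t → ℕ) (hk : ∀ j, 0 < k j)
    (hpow : ∀ j, ((b j : A)) ^ (k j + 1) = 0)
    (hsum : r * (∑ j, k j) < n) :
    (∀ (c : ℕ) (a : Fin c → A) (d : Fin c → ℕ),
        (∀ j, 0 < d j) → (∀ j, a j ∈ 𝒜 (d j)) → (∏ j, a j) ≠ 0 →
        c ≤ (∑ j, k j) + (n - r * (∑ j, k j)) / q) ∧
    ((((∑ j, k j) + (n - r * (∑ j, k j)) / q : ℕ) : ℚ) < (n : ℚ) / (r : ℚ)) := by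
  set K := ∑ j, k j with hK
  constructor
  · intro c a d hd ha hne
    have hane : ∀ j, a j ≠ 0 := fun j h0 =>
      hne (Finset.prod_eq_zero (Finset.mem_univ j) h0)
    have hdd : ∀ j, d j = r ∨ q ≤ d j := by
      intro j
      by_contra! hcon
      have hbot : 𝒜 (d j) = ⊥ := by
        rcases lt_or_gt_of_ne hcon.1 with h | h
        · exact hgap₁ _ (hd j) h
        · exact hgap₂ _ h hcon.2
      have := ha j
      rw [hbot] at this
      exact hane j (by simpa using this)
    have hdeg : ∑ j, d j ≤ n := by
      by_contra! hcon
      have hm := SetLike.prod_mem_graded 𝒜 d a (F := Finset.univ) (fun j _ => ha j)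
      rw [htop _ hcon] at hm
      exact hne (by simpa using hm)
    let I : Ideal A := ∑ j, Ideal.span {(b j : A)}
    have hI : I ^ (K + 1) = 0 := ideal_pow_zero Finset.univ (fun j => (b j : A)) k hpow
    have hmem : ∀ x ∈ 𝒜 r, x ∈ I := by
      intro x hx
      have h1 := b.sum_repr ⟨x, hx⟩
      have h2 : x = ∑ j, b.repr ⟨x, hx⟩ j • (b j : A) := by
        have := congrArg (Subtype.val) h1
        simpa only [Submodule.coe_sum, Submodule.coe_smul] using this.symm
      rw [h2]
      refine Ideal.sum_mem _ fun j _ => ?_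
      rw [Algebra.smul_def]
      refine Ideal.mul_mem_left _ _ ?_
      have hle : Ideal.span {(b j : A)} ≤ I :=
        Finset.single_le_sum (f := fun j => Ideal.span {(b j : A)})
          (fun _ _ => bot_le) (Finset.mem_univ j)
      exact hle (Ideal.mem_span_singleton_self _)
    let S : Finset (Fin c) := Finset.univ.filter (fun j => d j = r)
    have hs : S.card ≤ K := by
      by_contra! hcon
      have hp : ∏ j ∈ S, a j ∈ I ^ S.card := by
        rw [← Finset.prod_const]
        refine Ideal.prod_mem_prod fun j hj => hmem _ ?_
        have := ha j
        rwa [(Finset.mem_filter.mp hj).2] at this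
      have hp2 := Ideal.pow_le_pow_right (show K + 1 ≤ S.card from hcon) hp
      rw [hI] at hp2
      have hp3 : ∏ j ∈ S, a j = 0 := by simpa using hp2
      apply hne
      rw [← Finset.prod_mul_prod_compl S, hp3, zero_mul]
    have h1 : r * S.card + q * Sᶜ.card ≤ n := by
      refine le_trans ?_ hdeg
      rw [← Finset.sum_add_sum_compl S]
      refine add_le_add ?_ ?_
      · have := Finset.card_nsmul_le_sum S d r (fun j hj => (Finset.mem_filter.mp hj).2.ge)
        simpa [mul_comm] using this
      · have := Finset.card_nsmul_le_sum Sᶜ d q (fun j hj => by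
          rcases hdd j with h | h
          · simp [S, h] at hj
          · exact h)
        simpa [mul_comm] using this
    have hc : S.card + Sᶜ.card = c := by
      simp
    by_cases hcK : c ≤ K
    · exact hcK.trans (Nat.le_add_right _ _)
    have h2 : (c - K) ≤ (n - r * K) / q := by
      rw [Nat.le_div_iff_mul_le (by omega)]
      obtain ⟨e, he⟩ := Nat.exists_eq_add_of_le hs
      obtain ⟨f, hf⟩ := Nat.exists_eq_add_of_le (show K ≤ c by omega)
      have hf2 : Sᶜ.card = e + f := by omega
      have h3 : c - K = f := by omega
      rw [h3]
      apply Nat.le_sub_of_add_le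
      rw [hf2] at h1
      rw [he]
      nlinarith [Nat.mul_le_mul_right e hrq.le]
    exact Nat.sub_le_iff_le_add'.mp h2
  · rw [lt_div_iff₀ (by exact_mod_cast hr)]
    norm_cast
    have h1 : (n - r * K) / q * q ≤ n - r * K := Nat.div_mul_le_self _ _
    generalize (n - r * K) / q = f at *
    rcases Nat.eq_zero_or_pos f with h | h
    · subst h; nlinarith
    · have : f * r < f * q := Nat.mul_lt_mul_of_pos_left hrq h
      have h4 : f * r + r * K < n := by omega
      nlinarith
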